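/- arXiv:2310.00214 — 2 statements merged into one kernel-verified Lean document; each statement's English description precedes it below -/
import Mathlib

section
/- Let q be an odd prime power, h an even positive integer with (q+1)/h = 2τ+1 for some integer τ ≥ 1, let r be an odd integer with h < r < 3h/2, set n = r(q^2−1)/(2h) + 1, and let k be an integer with 1 ≤ k and 2hk ≤ (r+1)(q+1) − 2h. Then there exist pairwise distinct elements a_1,…,a_n of F_{q^2} and nonzero elements v_1,…,v_n of F_{q^2} such that Σ_{l=1}^n v_l^{q+1} a_l^{q·i+j} = 0 for all integers 0 ≤ i, j ≤ k−1 (with the convention 0^0 = 1); that is, the generalized Reed–Solomon code GRS_k(a,v) is a Hermitian self-orthogonal [n, k, n−k+1] MDS code over F_{q^2}, which by the Hermitian construction yields an [[n, n−2k, k+1]]_q quantum MDS code. -/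
open Finset

/-- A family of fewer than `#A` linear functionals, none vanishing identically on a set closed under
the combinations `w + a • v` with `a ∈ A`, is simultaneously nonzero at some point of that set. -/
lemma exists_mem_forall_apply_ne_zero {F V ι : Type*} [Field F] [AddCommGroup V] [Module F V]
    (W : Set V) (A : Finset F) (hW : ∀ a ∈ A, ∀ w ∈ W, ∀ v ∈ W, w + a • v ∈ W)
    (hne : W.Nonempty) (f : ι → V →ₗ[F] F) (s : Finset ι) (hs : #s < #A)
    (hf : ∀ i ∈ s, ∃ w ∈ W, f i w ≠ 0) : ∃ w ∈ W, ∀ i ∈ s, f i w ≠ 0 := by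
  classical
  induction s using Finset.induction_on with
  | empty => exact ⟨hne.some, hne.some_mem, by simp⟩
  | insert i s hi ih =>
    rw [card_insert_of_notMem hi] at hs
    obtain ⟨v, hv, hvs⟩ := ih (by omega) fun j hj => hf j (mem_insert_of_mem hj)
    obtain ⟨w, hw, hwi⟩ := hf i (mem_insert_self i s)
    by_cases hvi : f i v = 0
    · obtain ⟨a, ha, has⟩ := exists_mem_notMem_of_card_lt_card
        (lt_of_le_of_lt (card_image_le (s := s) (f := fun j => -(f j w) / f j v)) (by omega : #s < #A))
      refine ⟨w + a • v, hW a ha w hw v hv, fun j hj h0 => ?_⟩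
      simp only [map_add, map_smul, smul_eq_mul] at h0
      rcases mem_insert.1 hj with rfl | hj
      · simp [hvi, hwi] at h0
      · refine has (mem_image.2 ⟨j, hj, ?_⟩)
        rw [div_eq_iff (hvs j hj)]
        linear_combination -h0
    · refine ⟨v, hv, fun j hj => ?_⟩
      rcases mem_insert.1 hj with rfl | hj
      exacts [hvi, hvs j hj]

lemma FiniteField.exists_isPrimitiveRoot_card_sub_one (F : Type*) [Field F] [Fintype F] :
    ∃ g : F, IsPrimitiveRoot g (Fintype.card F - 1) := by
  classical
  obtain ⟨g, hg⟩ := IsCyclic.exists_generator (α := Fˣ)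
  refine ⟨g, IsPrimitiveRoot.coe_units_iff.2 ?_⟩
  have h := IsPrimitiveRoot.orderOf g
  rwa [orderOf_eq_card_of_forall_mem_zpowers hg, Nat.card_eq_fintype_card, Fintype.card_units] at h

/-- Surjectivity of the norm map of a quadratic extension of finite fields. -/
lemma exists_pow_succ_eq_of_pow_eq_self {F : Type*} [Field F] {q : ℕ} (hq : 1 < q) {g : F}
    (hg : IsPrimitiveRoot g (q ^ 2 - 1)) {c : F} (hc : c ≠ 0) (hcq : c ^ q = c) :
    ∃ v : F, v ≠ 0 ∧ v ^ (q + 1) = c := by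
  have hfac : q ^ 2 - 1 = (q + 1) * (q - 1) := by simpa using Nat.sq_sub_sq q 1
  have hc1 : c ^ (q - 1) = 1 := by
    have : c ^ (q - 1) * c = 1 * c := by rw [← pow_succ, Nat.sub_add_cancel hq.le, hcq, one_mul]
    exact mul_right_cancel₀ hc this
  have : NeZero (q ^ 2 - 1) := ⟨by rw [hfac]; exact Nat.mul_ne_zero (by omega) (by omega)⟩
  obtain ⟨i, -, rfl⟩ := hg.eq_pow_of_pow_eq_one (by rw [hfac, mul_comm, pow_mul, hc1, one_pow])
  rw [← pow_mul] at hc1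
  have hd := hg.dvd_of_pow_eq_one _ hc1
  rw [hfac] at hd
  obtain ⟨t, rfl⟩ := Nat.dvd_of_mul_dvd_mul_right (Nat.sub_pos_of_lt hq) hd
  refine ⟨g ^ t, fun h0 => hc ?_, ?_⟩
  · rw [mul_comm, pow_mul, h0, zero_pow (by omega)]
  · rw [← pow_mul, mul_comm]

/-- The multiples `λ m` of `m = T(HT - 1)` of the form `q i + j` with `i, j` small. -/
lemma odd_lt_or_even_mem_Icc_of_mul_add_eq {q H R τ k i j l : ℕ} (hH : 0 < H) (hτ : 1 ≤ τ)
    (hq : q + 1 = 2 * H * (2 * τ + 1)) (hR : 2 * R + 1 < 3 * H)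
    (hk : k + 1 ≤ (R + 1) * (2 * τ + 1)) (hi : i < k) (hj : j < k) (hij : q * i + j ≠ 0)
    (h : 2 * (q * i + j) = l * ((2 * τ + 1) * (q - 1))) :
    (∃ μ < H, l = 2 * μ + 1) ∨ ∃ μ, l = 2 * μ ∧ μ ≤ R ∧ 2 * H ≤ μ + R := by
  obtain ⟨T, hT⟩ : ∃ T : ℕ, T = 2 * τ + 1 := ⟨_, rfl⟩
  rw [← hT] at hq hk h
  have hT1 : 1 ≤ T := by omega
  have hHT : 1 ≤ H * T := Nat.mul_pos hH hT1
  have hq1 : 1 ≤ q := by nlinarith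
  zify [hq1] at *
  have hqv : (q : ℤ) = 2 * H * T - 1 := by linarith
  have hT0 : (T : ℤ) ≠ 0 := by positivity
  have hH0 : (H : ℤ) ≠ 0 := by positivity
  have h1 : (2 * H * T - 1) * (i : ℤ) + j = l * (T * (H * T - 1)) := by
    rw [hqv] at h; apply mul_left_cancel₀ (two_ne_zero (α := ℤ)); linear_combination h
  obtain ⟨d, hd⟩ : (T : ℤ) ∣ j - i := ⟨l * (H * T - 1) - 2 * H * i, by linear_combination h1⟩
  have h2 : 2 * (H : ℤ) * i + d = l * (H * T - 1) := by
    apply mul_left_cancel₀ hT0; linear_combination h1 - hd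
  obtain ⟨u, hu⟩ : ∃ u : ℤ, u = l * T - 2 * i := ⟨_, rfl⟩
  have h3 : d = H * u - l := by rw [hu]; linear_combination h2
  have h4 : (i : ℤ) + j = (T * H - 1) * u := by
    rw [h3] at hd; linear_combination hd + hu
  have hTH : 3 ≤ (T : ℤ) * H := by nlinarith
  have hij' : 0 < (i : ℤ) + j := by
    by_contra! h0
    have hi0 : (i : ℤ) = 0 := by omega
    have hj0 : (j : ℤ) = 0 := by omega
    exact hij (by rw [hi0, hj0]; ring)
  have hu0 : 0 < u := by
    rw [h4] at hij'
    exact pos_of_mul_pos_right hij' (by linarith)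
  have hRH : 2 * ((R : ℤ) + 1) * T ≤ 3 * H * T :=
    mul_le_mul_of_nonneg_right (by linarith) (by positivity)
  have hu3 : u < 3 := by
    by_contra! h3u
    nlinarith
  obtain rfl | rfl : u = 1 ∨ u = 2 := by omega
  · left
    have hl : l < 2 * H := by
      zify
      refine lt_of_mul_lt_mul_right (a := (T : ℤ)) ?_ (by positivity)
      linarith
    obtain ⟨μ, rfl | rfl⟩ := Nat.even_or_odd' l
    · push_cast at hu
      rw [mul_assoc] at hu
      omega
    · exact ⟨μ, by omega, rfl⟩
  · right
    obtain ⟨μ, rfl | rfl⟩ := Nat.even_or_odd' l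
    · push_cast at hu
      have hμ : (μ : ℤ) < R + 1 := by
        refine lt_of_mul_lt_mul_right (a := (T : ℤ)) ?_ (by positivity)
        linarith
      have hμ' : 2 * (H : ℤ) < μ + R + 1 := by
        refine lt_of_mul_lt_mul_right (a := (T : ℤ)) ?_ (by positivity)
        linarith
      exact ⟨μ, rfl, by omega, by omega⟩
    · push_cast at hu
      rw [add_mul, mul_assoc] at hu
      omega

lemma exists_coeff_ne_zero_of_forall_eval_odd_pow_eq_zero {F : Type*} [Field F] {θ : F} {H R : ℕ}
    (hθ : IsPrimitiveRoot θ (4 * H)) (hR : 2 * R + 1 < 3 * H) {M : Polynomial F}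
    (hM : M.Monic) (hdeg : M.natDegree + H = 2 * R + 1) (hM0 : M.coeff 0 ≠ 0)
    (hroot : ∀ μ < H, M.eval (θ ^ (2 * μ + 1)) = 0) {s : ℕ} (hs : s < 2 * R + 1) :
    ∃ i < H, i ≤ s ∧ M.coeff (s - i) ≠ 0 := by
  by_contra! hcon
  have hHs : H ≤ s := by
    by_contra! hlt
    exact hM0 (by simpa using hcon s hlt le_rfl)
  have hsD : s < M.natDegree := by
    by_contra! hle
    have := hcon (s - M.natDegree) (by omega) (by omega)
    rw [Nat.sub_sub_self hle, hM.coeff_natDegree] at this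
    exact one_ne_zero this
  have hsupp : M.support ⊆ range (M.natDegree + 1) \ Ioc (s - H) s := by
    intro t ht
    rw [Polynomial.mem_support_iff] at ht
    simp only [mem_sdiff, mem_range, mem_Ioc, not_and, not_le]
    refine ⟨Nat.lt_succ_of_le (Polynomial.le_natDegree_of_ne_zero ht), fun h1 => ?_⟩
    by_contra! h2
    have := hcon (s - t) (by omega) (by omega)
    rw [Nat.sub_sub_self h2] at this
    exact ht this
  have hcard : #M.support ≤ H := by
    refine (card_le_card hsupp).trans ?_
    rw [card_sdiff_of_subset, card_range, Nat.card_Ioc]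
    · omega
    · intro t; simp only [mem_Ioc, mem_range]; omega
  have h0 : 0 ∈ M.support := Polynomial.mem_support_iff.2 hM0
  -- evaluations against polynomials of degree less than `H` in `θ ^ (2 * t)` vanish
  have hdual : ∀ f : Polynomial F, f.natDegree < H →
      ∑ t ∈ M.support, M.coeff t * θ ^ t * f.eval (θ ^ (2 * t)) = 0 := by
    intro f hf
    simp_rw [Polynomial.eval_eq_sum_range' hf, mul_sum]
    rw [sum_comm]
    refine sum_eq_zero fun μ hμ => ?_
    have := hroot μ (mem_range.1 hμ)
    rw [Polynomial.eval_eq_sum, Polynomial.sum] at this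
    calc _ = f.coeff μ * ∑ t ∈ M.support, M.coeff t * (θ ^ (2 * μ + 1)) ^ t := by
          rw [mul_sum]; exact sum_congr rfl fun t _ => by ring
      _ = 0 := by rw [this, mul_zero]
  have hf := hdual (∏ t ∈ M.support.erase 0, (Polynomial.X - Polynomial.C (θ ^ (2 * t)))) (by
    rw [Polynomial.natDegree_finsetProd_X_sub_C_eq_card, card_erase_of_mem h0]
    have := card_pos.2 ⟨0, h0⟩
    omega)
  rw [← add_sum_erase _ _ h0, sum_eq_zero, add_zero] at hf
  · simp only [Polynomial.eval_prod, mul_eq_zero, hM0, false_or, pow_zero, mul_zero, one_ne_zero,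
      prod_eq_zero_iff] at hf
    obtain ⟨t, ht, h⟩ := hf
    simp only [Polynomial.eval_sub, Polynomial.eval_X, Polynomial.eval_C, sub_eq_zero] at h
    have hd := Nat.le_of_dvd (by have := (mem_erase.1 ht).1; omega) (hθ.dvd_of_pow_eq_one _ h.symm)
    have := Polynomial.le_natDegree_of_mem_supp t (mem_of_mem_erase ht)
    omega
  · intro t ht
    rw [Polynomial.eval_prod, prod_eq_zero ht (by simp), mul_zero]

/-- A product of linear factors is fixed by a ring endomorphism that permutes the roots by the
reflection of the index range. -/
lemma Polynomial.map_prod_range_X_sub_C_of_reflect {F : Type*} [CommRing F] (φ : F →+* F) (N : ℕ)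
    (f : ℕ → F) (hf : ∀ i < N, φ (f i) = f (N - 1 - i)) :
    (∏ i ∈ range N, (Polynomial.X - Polynomial.C (f i))).map φ =
      ∏ i ∈ range N, (Polynomial.X - Polynomial.C (f i)) := by
  rw [Polynomial.map_prod, ← prod_range_reflect (fun i => Polynomial.X - Polynomial.C (f i))]
  refine prod_congr rfl fun i hi => ?_
  rw [Polynomial.map_sub, Polynomial.map_X, Polynomial.map_C, hf i (mem_range.1 hi)]

lemma exists_fixed_polynomial_coeff_ne_zero {F : Type*} [Field F] (φ : F →+* F) {q H R : ℕ}
    (hφ : ∀ x, φ x = x ^ q) {θ : F} (hθ : IsPrimitiveRoot θ (4 * H)) (hθ2 : θ ^ (2 * H) = -1)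
    (hθq : θ ^ (q + 1) = -1) (hHR : H ≤ R) (hR : 2 * R + 1 < 3 * H) (A : Finset F)
    (hA : ∀ a ∈ A, φ a = a) (hcard : 2 * R + 2 < #A) :
    ∃ c : Polynomial F, c.map φ = c ∧ c.natDegree < 2 * R + 1 ∧
      (∀ s < 2 * R + 1, c.coeff s ≠ 0) ∧ c.eval 1 ≠ 0 ∧
      (∀ μ < H, c.eval (θ ^ (2 * μ + 1)) = 0) ∧
      ∀ μ, μ ≤ R → 2 * H ≤ μ + R → c.eval (θ ^ (2 * μ)) = 0 := by
  have hθ0 : θ ≠ 0 := hθ.ne_zero (by omega)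
  have hθ4 : θ ^ (4 * H) = 1 := hθ.pow_eq_one
  have hφθ : ∀ a b, θ ^ (a + b) = (-1) ^ a → φ (θ ^ a) = θ ^ b := by
    intro a b hab
    apply mul_left_cancel₀ (pow_ne_zero a hθ0)
    rw [hφ, ← pow_add, hab, ← hθq]
    ring
  set M₁ := ∏ μ ∈ range H, (Polynomial.X - Polynomial.C (θ ^ (2 * μ + 1))) with hM₁
  set M₂ := ∏ i ∈ range (2 * R + 1 - 2 * H),
    (Polynomial.X - Polynomial.C (θ ^ (2 * (2 * H - R + i)))) with hM₂
  have hm₁ : M₁.Monic := Polynomial.monic_prod_X_sub_C _ _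
  have hm₂ : M₂.Monic := Polynomial.monic_prod_X_sub_C _ _
  have hφ₁ : M₁.map φ = M₁ := by
    refine Polynomial.map_prod_range_X_sub_C_of_reflect φ H _ fun i hi => hφθ _ _ ?_
    rw [show 2 * i + 1 + (2 * (H - 1 - i) + 1) = 2 * H by omega, hθ2, pow_succ, pow_mul]
    simp
  have hφ₂ : M₂.map φ = M₂ := by
    refine Polynomial.map_prod_range_X_sub_C_of_reflect φ _ (fun i => θ ^ (2 * (2 * H - R + i)))
      fun i hi => hφθ _ _ ?_
    rw [show 2 * (2 * H - R + i) + 2 * (2 * H - R + (2 * R + 1 - 2 * H - 1 - i)) = 4 * H by omega,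
      hθ4, pow_mul]
    simp
  have hroot₁ : ∀ μ < H, M₁.eval (θ ^ (2 * μ + 1)) = 0 := fun μ hμ => by
    rw [hM₁, Polynomial.eval_prod, prod_eq_zero (mem_range.2 hμ) (by simp)]
  have hroot₂ : ∀ μ, μ ≤ R → 2 * H ≤ μ + R → M₂.eval (θ ^ (2 * μ)) = 0 := fun μ h1 h2 => by
    rw [hM₂, Polynomial.eval_prod, prod_eq_zero (i := μ - (2 * H - R)) (mem_range.2 (by omega))]
    rw [show 2 * H - R + (μ - (2 * H - R)) = μ by omega]
    simp
  have hne1 : ∀ a, 0 < a → a < 4 * H → θ ^ a ≠ 1 := fun a h1 h2 =>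
    hθ.pow_ne_one_of_pos_of_lt (by omega) h2
  have heval : (M₁ * M₂).eval 1 ≠ 0 := by
    rw [Polynomial.eval_mul, hM₁, hM₂, Polynomial.eval_prod, Polynomial.eval_prod]
    refine mul_ne_zero (prod_ne_zero_iff.2 fun i hi => ?_) (prod_ne_zero_iff.2 fun i hi => ?_) <;>
    · rw [mem_range] at hi
      rw [Polynomial.eval_sub, Polynomial.eval_X, Polynomial.eval_C, sub_ne_zero]
      exact (hne1 _ (by omega) (by omega)).symm
  have hcoeff : (M₁ * M₂).coeff 0 ≠ 0 := by
    rw [Polynomial.coeff_zero_eq_eval_zero, Polynomial.eval_mul, hM₁, hM₂, Polynomial.eval_prod,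
      Polynomial.eval_prod]
    refine mul_ne_zero (prod_ne_zero_iff.2 fun i _ => ?_) (prod_ne_zero_iff.2 fun i _ => ?_) <;>
    · rw [Polynomial.eval_sub, Polynomial.eval_X, Polynomial.eval_C, zero_sub, neg_ne_zero]
      exact pow_ne_zero _ hθ0
  have hdeg : (M₁ * M₂).natDegree + H = 2 * R + 1 := by
    rw [hm₁.natDegree_mul hm₂, hM₁, hM₂, Polynomial.natDegree_finsetProd_X_sub_C_eq_card,
      Polynomial.natDegree_finsetProd_X_sub_C_eq_card, card_range, card_range]
    omega
  have hm : (M₁ * M₂).Monic := hm₁.mul hm₂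
  have hφM : (M₁ * M₂).map φ = M₁ * M₂ := by rw [Polynomial.map_mul, hφ₁, hφ₂]
  have hrM : ∀ μ < H, (M₁ * M₂).eval (θ ^ (2 * μ + 1)) = 0 := fun μ hμ => by
    rw [Polynomial.eval_mul, hroot₁ μ hμ, zero_mul]
  have hrM' : ∀ μ, μ ≤ R → 2 * H ≤ μ + R → (M₁ * M₂).eval (θ ^ (2 * μ)) = 0 := fun μ h1 h2 => by
    rw [Polynomial.eval_mul, hroot₂ μ h1 h2, mul_zero]
  clear_value M₁ M₂
  generalize M₁ * M₂ = M at *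
  have hMX : ∀ i < H, (M * Polynomial.X ^ i) ∈ {c : Polynomial F | c.map φ = c ∧
      c.natDegree < 2 * R + 1 ∧ M ∣ c} := fun i hi =>
    ⟨by simp [hφM],
      by rw [hm.natDegree_mul (Polynomial.monic_X_pow i), Polynomial.natDegree_X_pow]; omega,
      dvd_mul_right _ _⟩
  obtain ⟨c, ⟨hc1, hc2, d, rfl⟩, hc⟩ := exists_mem_forall_apply_ne_zero
    {c : Polynomial F | c.map φ = c ∧ c.natDegree < 2 * R + 1 ∧ M ∣ c} A
    (fun a ha w hw v hv => ⟨by simp [Polynomial.smul_eq_C_mul, hw.1, hv.1, hA a ha],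
      lt_of_le_of_lt (Polynomial.natDegree_add_le _ _)
        (max_lt hw.2.1 ((Polynomial.natDegree_smul_le a v).trans_lt hv.2.1)),
      dvd_add hw.2.2 (hv.2.2.trans (by rw [Polynomial.smul_eq_C_mul]; exact dvd_mul_left _ _))⟩)
    ⟨_, hMX 0 (by omega)⟩
    (fun o : Option (Fin (2 * R + 1)) => o.elim (Polynomial.leval 1)
      fun s => Polynomial.lcoeff F s) univ (by simpa using hcard) (by
    rintro (_ | s) -
    · exact ⟨_, hMX 0 (by omega), by simpa using heval⟩
    · obtain ⟨i, hi, his, hne⟩ := exists_coeff_ne_zero_of_forall_eval_odd_pow_eq_zero hθ hR hm hdeg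
        hcoeff hrM s.2
      refine ⟨_, hMX i hi, ?_⟩
      simpa [Polynomial.coeff_mul_X_pow', his] using hne)
  refine ⟨M * d, hc1, hc2, fun s hs => ?_, ?_, fun μ hμ => ?_, fun μ h1 h2 => ?_⟩
  · simpa using hc (some ⟨s, hs⟩) (mem_univ _)
  · simpa using hc none (mem_univ _)
  · rw [Polynomial.eval_mul, hrM μ hμ, zero_mul]
  · rw [Polynomial.eval_mul, hrM' μ h1 h2, zero_mul]

lemma FiniteField.exists_ringHom_eq_pow {F : Type*} [Field F] [Fintype F] {q : ℕ}
    (hq : IsPrimePow q) (hF : Fintype.card F = q ^ 2) : ∃ φ : F →+* F, ∀ x, φ x = x ^ q := by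
  obtain ⟨p, a, hp, -, rfl⟩ := hq
  have : Fact p.Prime := ⟨hp.nat_prime⟩
  have : CharP F p := charP_of_card_eq_prime_pow (f := a * 2) (by rw [hF, pow_mul])
  exact ⟨iterateFrobenius F p a, iterateFrobenius_def p a⟩

theorem thm_qplus_len_plus_one_case1
    (q h τ r n : ℕ) (hq : IsPrimePow q) (hqo : Odd q)
    (hh : 0 < h) (hhe : Even h) (hτ : 1 ≤ τ)
    (hdiv : q + 1 = h * (2 * τ + 1))
    (hro : Odd r) (hr1 : h < r) (hr2 : 2 * r < 3 * h)  -- i.e. odd r, h < r < 3h/2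
    -- n = r(q²-1)/(2h) + 1
    (hn : 2 * h * n = r * (q ^ 2 - 1) + 2 * h)
    (k : ℕ) (hk1 : 1 ≤ k)
    -- k ≤ (r+1)(q+1)/(2h) - 1
    (hk : 2 * h * k + 2 * h ≤ (r + 1) * (q + 1))
    (F : Type*) [Field F] [Fintype F] (hF : Fintype.card F = q ^ 2) :
    ∃ a v : Fin n → F, Function.Injective a ∧ (∀ l, v l ≠ 0) ∧
      ∀ i j : ℕ, i < k → j < k →
        ∑ l, v l ^ (q + 1) * a l ^ (q * i + j) = 0 := by
  obtain ⟨H, rfl⟩ := even_iff_exists_two_mul.1 hhe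
  obtain ⟨R, rfl⟩ := hro
  obtain ⟨w, hqw⟩ := hqo
  classical
  obtain ⟨φ, hφ⟩ := FiniteField.exists_ringHom_eq_pow hq hF
  obtain ⟨g, hg⟩ := FiniteField.exists_isPrimitiveRoot_card_sub_one F
  rw [hF] at hg
  have hw : 0 < w := by
    have := hq.one_lt
    omega
  obtain ⟨m, hm⟩ : ∃ m, m = (2 * τ + 1) * w := ⟨_, rfl⟩
  have hm0 : 0 < m := hm ▸ Nat.mul_pos (by omega) hw
  have hsq : q ^ 2 - 1 = (q + 1) * (2 * w) := by
    rw [show 2 * w = q - 1 by omega]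
    simpa using Nat.sq_sub_sq q 1
  have hord : q ^ 2 - 1 = 4 * H * m := by rw [hsq, hdiv, hm]; ring
  have hH : 0 < H := by omega
  have hnm : n = (2 * R + 1) * m + 1 := by
    rw [hord] at hn
    apply Nat.eq_of_mul_eq_mul_left (by omega : 0 < 2 * (2 * H))
    rw [hn]; ring
  have hkR : k + 1 ≤ (R + 1) * (2 * τ + 1) := by
    rw [hdiv] at hk
    apply Nat.le_of_mul_le_mul_left _ (by omega : 0 < 4 * H)
    linarith
  have hθ : IsPrimitiveRoot (g ^ m) (4 * H) :=
    hg.pow (by rw [hord]; positivity) (by rw [hord, mul_comm])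
  have hθ2 : (g ^ m) ^ (2 * H) = -1 :=
    (hθ.pow (by omega) (by ring : 4 * H = 2 * H * 2)).eq_neg_one_of_two_right
  have hθq : (g ^ m) ^ (q + 1) = -1 := by
    rw [hdiv, pow_mul, hθ2, pow_succ, pow_mul]
    simp
  have hAq : 2 * R + 2 < 2 * w := by nlinarith
  have hgA : IsPrimitiveRoot (g ^ (q + 1)) (2 * w) :=
    hg.pow (by rw [hord]; positivity) hsq
  have hHR : H ≤ R := by omega
  have hRH : 2 * R + 1 < 3 * H := by omega
  obtain ⟨c, hcφ, hcdeg, hcne, hc1, hcodd, hceven⟩ := exists_fixed_polynomial_coeff_ne_zero φ hφ hθ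
    hθ2 hθq hHR hRH ((range (2 * w)).image fun i => (g ^ (q + 1)) ^ i) (by
      intro x hx
      obtain ⟨i, -, rfl⟩ := mem_image.1 hx
      rw [hφ, pow_right_comm, hqw, pow_succ (g ^ _), ← hqw, hgA.pow_eq_one, one_mul]) (by
      rwa [card_image_of_injOn fun i hi j hj hij =>
        hgA.pow_inj (mem_range.1 hi) (mem_range.1 hj) hij, card_range])
  have hq1 : 1 < q := by omega
  have hmF : (m : F) ≠ 0 := fun h0 => by
    have h1 := FiniteField.cast_card_eq_zero F
    rw [hF, ← Nat.sub_add_cancel (Nat.one_le_pow 2 q (by omega)), hord] at h1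
    simp [h0] at h1
  have hv : ∀ s : Fin (2 * R + 1), ∃ v : F, v ≠ 0 ∧ v ^ (q + 1) = c.coeff s := fun s =>
    exists_pow_succ_eq_of_pow_eq_self hq1 hg (hcne s s.2) (by
      rw [← hφ, ← Polynomial.coeff_map, hcφ])
  choose v hv0 hvc using hv
  obtain ⟨u, hu0, huc⟩ := exists_pow_succ_eq_of_pow_eq_self hq1 hg
    (neg_ne_zero.2 (mul_ne_zero hmF hc1)) (by
      rw [← hφ, map_neg, map_mul, map_natCast, ← Polynomial.eval_one_map, hcφ])
  have hcard : Fintype.card (Fin n) = Fintype.card (Option (Fin (2 * R + 1) × Fin m)) := by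
    simp [hnm]
  let e := Fintype.equivOfCardEq hcard
  let a : Option (Fin (2 * R + 1) × Fin m) → F := fun o =>
    o.elim 0 fun x => g ^ ((x.1 : ℕ) + 4 * H * x.2)
  let b : Option (Fin (2 * R + 1) × Fin m) → F := fun o => o.elim u fun x => v x.1
  have hg0 : g ≠ 0 := hg.ne_zero (by rw [hord]; positivity)
  have ha : Function.Injective a := by
    rintro (_ | ⟨s, t⟩) (_ | ⟨s', t'⟩) hst
    · rfl
    · exact absurd hst.symm (pow_ne_zero _ hg0)
    · exact absurd hst (pow_ne_zero _ hg0)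
    · have hlt : ∀ (s : Fin (2 * R + 1)) (t : Fin m), (s : ℕ) + 4 * H * t < q ^ 2 - 1 := by
        intro s t
        rw [hord]
        nlinarith [s.2, t.2]
      have h1 : (s : ℕ) + 4 * H * t = s' + 4 * H * t' := hg.pow_inj (hlt s t) (hlt s' t') hst
      have h2 := congrArg (· / (4 * H)) h1
      have hs : (s : ℕ) < 4 * H := by omega
      have hs' : (s' : ℕ) < 4 * H := by omega
      simp only [Nat.add_mul_div_left _ _ (by omega : 0 < 4 * H), Nat.div_eq_of_lt hs,
        Nat.div_eq_of_lt hs', zero_add] at h2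
      rw [h2] at h1
      rw [Fin.ext h2, Fin.ext (Nat.add_right_cancel h1)]
  refine ⟨a ∘ e, b ∘ e, ha.comp e.injective, fun l => ?_, fun i j hi hj => ?_⟩
  · rcases h : e l with _ | x
    · simpa [b, h] using hu0
    · simpa [b, h] using hv0 x.1
  simp only [Function.comp_apply]
  rw [e.sum_comp fun o => b o ^ (q + 1) * a o ^ (q * i + j), Fintype.sum_option,
    Fintype.sum_prod_type]
  simp only [a, b, Option.elim, huc, hvc]
  have hsum : ∀ s : Fin (2 * R + 1),
      ∑ t : Fin m, c.coeff s * (g ^ ((s : ℕ) + 4 * H * t)) ^ (q * i + j) =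
        c.coeff s * (g ^ (q * i + j)) ^ (s : ℕ) *
          ∑ t ∈ range m, ((g ^ (4 * H)) ^ (q * i + j)) ^ t := by
    intro s
    rw [← Fin.sum_univ_eq_sum_range (fun t => ((g ^ (4 * H)) ^ (q * i + j)) ^ t), mul_sum]
    exact sum_congr rfl fun t _ => by ring
  simp_rw [hsum]
  rw [← sum_mul, Fin.sum_univ_eq_sum_range (fun s => c.coeff s * (g ^ (q * i + j)) ^ s),
    ← Polynomial.eval_eq_sum_range' hcdeg]
  have hgm : IsPrimitiveRoot (g ^ (4 * H)) m := hg.pow (by rw [hord]; positivity) hord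
  by_cases hE : q * i + j = 0
  · rw [hE]
    simp
    ring
  rw [zero_pow hE, mul_zero, zero_add]
  by_cases hd : m ∣ q * i + j
  · obtain ⟨l, hl⟩ := hd
    rw [hl, pow_mul]
    rcases odd_lt_or_even_mem_Icc_of_mul_add_eq hH hτ hdiv hRH hkR hi hj hE
      (l := l) (by rw [hl, hm, hqw, Nat.add_sub_cancel]; ring) with
      ⟨μ, hμ, rfl⟩ | ⟨μ, rfl, h1, h2⟩
    · rw [hcodd μ hμ, zero_mul]
    · rw [hceven μ h1 h2, zero_mul]
  · have h1 : (g ^ (4 * H)) ^ (q * i + j) ≠ 1 := fun h => hd (hgm.dvd_of_pow_eq_one _ h)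
    rw [geom_sum_eq h1, pow_right_comm, hgm.pow_eq_one]
    simp
end

section
/- Let q be an odd prime power, h an even positive integer with (q+1)/h = 2τ+1 for some integer τ ≥ 1, let r be an odd integer with 3h/2 < r < 2h, set n = r(q^2−1)/(2h) + 1, and let k be an integer with 1 ≤ k and 2hk ≤ r(q+1) − 3h. Then there exist pairwise distinct elements a_1,…,a_n of F_{q^2} and nonzero elements v_1,…,v_n of F_{q^2} such that Σ_{l=1}^n v_l^{q+1} a_l^{q·i+j} = 0 for all integers 0 ≤ i, j ≤ k−1 (with the convention 0^0 = 1); that is, the generalized Reed–Solomon code GRS_k(a,v) is a Hermitian self-orthogonal [n, k, n−k+1] MDS code over F_{q^2}, which by the Hermitian construction yields an [[n, n−2k, k+1]]_q quantum MDS code. -/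
open Finset

/-- The exponents of the power sums occurring in the construction are divisible by `q ^ 2 - 1`
only when they vanish. -/
theorem exponent_eq_zero (q h T τ r k m i j e t : ℤ)
    (hh : 2 ≤ h) (hhe : Even h) (hτ : 1 ≤ τ) (hT : T = 2 * τ + 1) (hdiv : q + 1 = h * T)
    (hm : 2 * m = (q - 1) * T)
    (hro : Odd r) (hr1 : 3 * h < 2 * r) (hr2 : r < 2 * h)
    (hk : 2 * k + 3 ≤ r * T) (hi0 : 0 ≤ i) (hj0 : 0 ≤ j) (hi : i < k) (hj : j < k)
    (he0 : 0 ≤ e) (he : e ≤ 2 * h - r) (hE : q * i + j + m * (h - 1) * e = 2 * h * m * t) :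
    i = 0 ∧ j = 0 ∧ e = 0 := by
  obtain ⟨h', rfl⟩ := hhe
  obtain ⟨ρ, rfl⟩ := hro
  have hT3 : 3 ≤ T := by omega
  have hq : 5 ≤ q := by nlinarith
  have hQ : 0 < q - 1 := by omega
  set μ := 2 * (h' + h') * t - (h' + h' - 1) * e with hμ
  have h1 : 2 * (q * i + j) = (q - 1) * (T * μ) := by
    rw [hμ]; linear_combination 2 * hE + (2 * (h' + h') * t - (h' + h' - 1) * e) * hm
  -- `i + j` is a half-integral multiple of `q - 1`
  set g := T * μ - 2 * i with hg
  have h2 : 2 * (i + j) = (q - 1) * g := by rw [hg]; linear_combination h1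
  have hjT : 2 * j + g = T * ((h' + h') * g - μ) := by
    linear_combination h2 + g * hdiv - 2 * hg
  have hg0 : 0 ≤ g := by
    by_contra hc; nlinarith
  have hkq : k + 2 ≤ q := by nlinarith
  have hg4 : g < 4 := by
    by_contra hc; nlinarith
  have hTi : T * μ = 2 * i + g := by rw [hg]; ring
  have hT2 : T * (2 * ρ + 1) = 2 * (T * ρ) + 2 * τ + 1 := by rw [hT]; ring
  have hkρ : k + 1 ≤ T * ρ + τ := by linarith [hk, hT2, mul_comm T (2*ρ+1)]
  have hμe : μ = 4 * (h' * t) - 2 * (h' * e) + e := by rw [hμ]; ring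
  have hlt : ∀ x c : ℤ, T * x = 2 * c + g → c < k → x ≤ 2 * ρ := by
    intro x c hx hc
    by_contra hcon
    have : T * (2 * ρ + 1) ≤ T * x := mul_le_mul_of_nonneg_left (by omega) (by omega)
    linarith
  have hpos : ∀ x c : ℤ, T * x = 2 * c + g → 0 ≤ c → 0 < g → 0 < x := by
    intro x c hx hc hg'
    by_contra hcon
    nlinarith
  clear_value g μ
  have hμ1 := hlt μ i hTi hi
  have hμ2 := hlt _ j hjT.symm hj
  have hno : ∀ w y : ℤ, y = (h' + h') * (2 * w) → -(2 * (h' + h')) < y → y < 2 * (h' + h') →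
      y = 0 := by
    intro w y hy hy1 hy2
    have : w = 0 := by
      have h3 : w < 1 := by by_contra hc; nlinarith
      have h4 : -1 < w := by by_contra hc; nlinarith
      omega
    rw [hy, this]; ring
  rcases (by omega : g = 0 ∨ 0 < g) with hg0' | hgp
  · rw [hg0', mul_zero] at h2
    have hi' : i = 0 := by omega
    have hj' : j = 0 := by omega
    refine ⟨hi', hj', ?_⟩
    have hμ0 : μ = 0 := by
      have : T * μ = 0 := by omega
      rcases mul_eq_zero.mp this with h | h <;> omega
    have hpar : ∃ w, e - 2 * t = 2 * w := ⟨(e - 2 * t) / 2, by omega⟩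
    obtain ⟨w, hw⟩ := hpar
    exact hno w e (by rw [← hw]; linear_combination hμ0 - hμe) (by omega) (by omega)
  exfalso
  have hμp := hpos μ i hTi hi0 hgp
  have hμp' := hpos _ j hjT.symm hj0 hgp
  rcases Int.even_or_odd e with ⟨f, hf⟩ | ⟨f, hf⟩
  · have hg2 : g = 2 := by
      obtain ⟨μ', hμ'⟩ : ∃ μ', μ = 2 * μ' := ⟨μ / 2, by omega⟩
      have : T * μ = 2 * (T * μ') := by rw [hμ']; ring
      omega
    rw [hg2] at hμ2
    have := hno (t - f) (μ - e) (by rw [hμe, hf]; ring) (by omega) (by omega)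
    omega
  · have hodd : g = 1 ∨ g = 3 := by
      obtain ⟨μ', hμ'⟩ : ∃ μ', μ = 2 * μ' + 1 := ⟨μ / 2, by omega⟩
      have : T * μ = 2 * (T * μ' + τ) + 1 := by rw [hμ', hT]; ring
      omega
    have hz := hno (t - f - 1) (μ - e - (h' + h')) (by rw [hμe, hf]; ring)
    rcases hodd with hg1 | hg1 <;> rw [hg1] at hμ2 hμp'
    · have := hz (by omega) (by omega)
      omega
    · have := hz (by omega) (by omega)
      omega

theorem FiniteField.add_pow_of_card_eq_sq {F : Type*} [Field F] [Fintype F] {q : ℕ}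
    (hq : IsPrimePow q) (hF : Fintype.card F = q ^ 2) (x y : F) :
    (x + y) ^ q = x ^ q + y ^ q := by
  obtain ⟨p, s, hp, -, rfl⟩ := hq
  have hp' : p.Prime := hp.nat_prime
  have := Fact.mk hp'
  have : CharP F p := by
    refine (CharP.charP_iff_prime_eq_zero hp').2 ?_
    have h : ((Fintype.card F : ℕ) : F) = 0 := FiniteField.cast_card_eq_zero F
    rw [hF] at h
    push_cast at h
    exact eq_zero_of_pow_eq_zero (eq_zero_of_pow_eq_zero h)
  exact add_pow_char_pow x y p s

theorem FiniteField.sum_pow_eq_zero {F : Type*} [Field F] [Fintype F] {E : ℕ}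
    (hE : (Fintype.card F - 1) ∣ E → E = 0) : ∑ x : F, x ^ E = 0 := by
  classical
  by_cases h0 : E = 0
  · simp [h0]
  have hd := mt hE h0
  have := FiniteField.sum_pow_units F E
  rw [if_neg hd] at this
  rw [← Fintype.sum_subtype_add_sum_subtype (fun x : F => x ≠ 0)]
  rw [← (unitsEquivNeZero (G₀ := F)).sum_comp]
  have hz : ∀ x : {x : F // ¬ x ≠ 0}, (x : F) ^ E = 0 := fun x => by
    rw [not_not.1 x.2, zero_pow h0]
  simpa [hz] using this

theorem FiniteField.exists_pow_succ_eq {F : Type*} [Field F] [Fintype F] {q : ℕ}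
    (hF : Fintype.card F = q ^ 2) (hq : 2 ≤ q) {u : F} (hu : u ≠ 0) (huq : u ^ q = u) :
    ∃ v : F, v ^ (q + 1) = u := by
  obtain ⟨g, hg⟩ := IsCyclic.exists_generator (α := Fˣ)
  have ho : orderOf g = (q + 1) * (q - 1) := by
    rw [orderOf_eq_card_of_forall_mem_zpowers hg, Nat.card_units, Nat.card_eq_fintype_card, hF,
      ← Nat.sq_sub_sq, one_pow]
  obtain ⟨t, ht⟩ := (mem_powers_iff_mem_zpowers (x := g)).2 (hg (Units.mk0 u hu))
  have h1 : (g ^ t) ^ (q - 1) = 1 := by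
    simp only at ht
    rw [ht]
    ext
    have : u * u ^ (q - 1) = u * 1 := by rw [mul_one, ← pow_succ', Nat.sub_add_cancel (by omega), huq]
    simpa using mul_left_cancel₀ hu this
  rw [← pow_mul] at h1
  have h2 := orderOf_dvd_of_pow_eq_one h1
  rw [ho] at h2
  obtain ⟨c, rfl⟩ := Nat.dvd_of_mul_dvd_mul_right (by omega) h2
  refine ⟨(g ^ c : Fˣ), ?_⟩
  have := congrArg Units.val ht
  simp only [Units.val_mk0] at this
  rw [← this, mul_comm, pow_mul]
  simp

theorem FiniteField.exists_trace_ne_zero {F : Type*} [Field F] [Fintype F] {q : ℕ}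
    (hF : Fintype.card F = q ^ 2) (hq : 2 ≤ q) {W : Finset F} (hW : 0 ∉ W) (hWq : #W < q) :
    ∃ α : F, ∀ w ∈ W, α * w + (α * w) ^ q ≠ 0 := by
  classical
  open Polynomial in
  by_contra! hc
  let P : F[X] := ∏ w ∈ W, (C w * X + C (w ^ q) * X ^ q)
  have hdeg : P.natDegree < Fintype.card F := by
    rw [hF]
    calc P.natDegree ≤ ∑ w ∈ W, (C w * X + C (w ^ q) * X ^ q).natDegree := natDegree_prod_le _ _
      _ ≤ ∑ w ∈ W, q := by
        refine sum_le_sum fun w _ => natDegree_add_le_of_degree_le ?_ (natDegree_C_mul_X_pow_le _ _)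
        exact (natDegree_C_mul_le _ _ |>.trans natDegree_X_le).trans (by omega)
      _ = #W * q := by simp
      _ < q ^ 2 := by nlinarith
  have hP : P = 0 := by
    refine eq_zero_of_natDegree_lt_card_of_eval_eq_zero P Function.injective_id (fun α => ?_) hdeg
    obtain ⟨w, hw, hw0⟩ := hc α
    rw [eval_prod]
    refine prod_eq_zero hw ?_
    rw [← hw0]
    simp only [eval_add, eval_mul, eval_C, eval_X, eval_pow, id_eq, mul_pow]
    ring
  obtain ⟨w, hw, hw0⟩ := prod_eq_zero_iff.1 hP
  have h1 := congrArg (fun p => coeff p 1) hw0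
  simp only [coeff_add, coeff_C_mul, coeff_X_one, coeff_X_pow, coeff_zero, mul_one,
    if_neg (show (1 : ℕ) ≠ q by omega), mul_zero, add_zero] at h1
  exact hW (h1 ▸ hw)

theorem IsCyclic.card_filter_pow_mem {G : Type*} [CommGroup G] [IsCyclic G] [Fintype G]
    [DecidableEq G] (d : ℕ) {Z : Finset G} (hZ : ∀ ζ ∈ Z, ∃ g : G, g ^ d = ζ) :
    #{g : G | g ^ d ∈ Z} = #Z * (Fintype.card G).gcd d := by
  have h1 : ∀ ζ ∈ Z, #{g : G | g ^ d = ζ} = (Fintype.card G).gcd d := by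
    intro ζ hζ
    have := MonoidHom.card_fiber_eq_of_mem_range (powMonoidHom d : G →* G) (x := ζ) (y := 1)
      (hZ ζ hζ) ⟨1, by simp⟩
    simp only [powMonoidHom_apply] at this
    rw [this, ← Nat.card_eq_fintype_card, ← IsCyclic.card_powMonoidHom_ker, ← Fintype.card_subtype,
      ← Nat.card_eq_fintype_card]
    rfl
  rw [card_eq_sum_card_fiberwise (f := fun g => g ^ d) (t := Z) (by intro g; simp)]
  rw [← smul_eq_mul, ← sum_const]
  refine sum_congr rfl fun ζ hζ => ?_
  rw [← h1 ζ hζ, filter_filter]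
  congr 1
  ext g
  simp only [mem_filter, mem_univ, true_and]
  exact ⟨fun h => h.2, fun h => ⟨h ▸ hζ, h⟩⟩

open Polynomial in
theorem sum_trace_mul_pow_eq_zero {F : Type*} [Field F] [Fintype F] {q : ℕ}
    (hq : IsPrimePow q) (hF : Fintype.card F = q ^ 2) (P : F[X]) (M k : ℕ)
    (hP : ∀ e i j : ℕ, e ≤ P.natDegree → i < k → j < k →
      q ^ 2 - 1 ∣ M * e + (q * i + j) → M * e + (q * i + j) = 0)
    {i j : ℕ} (hi : i < k) (hj : j < k) :
    ∑ a : F, (P.eval (a ^ M) + P.eval (a ^ M) ^ q) * a ^ (q * i + j) = 0 := by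
  have hq0 : q ≠ 0 := hq.ne_zero
  have key : ∀ i j : ℕ, i < k → j < k → ∑ a : F, P.eval (a ^ M) * a ^ (q * i + j) = 0 := by
    intro i j hi hj
    simp_rw [eval_eq_sum_range, sum_mul]
    rw [sum_comm]
    refine sum_eq_zero fun e he => ?_
    simp_rw [mul_assoc, ← pow_mul, ← pow_add]
    rw [← mul_sum, FiniteField.sum_pow_eq_zero, mul_zero]
    rw [hF]
    exact hP e i j (by simpa [Nat.lt_succ_iff] using he) hi hj
  have hsum : ∀ f : F → F, (∑ a, f a) ^ q = ∑ a, f a ^ q := fun f =>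
    map_sum ({ toFun := fun x => x ^ q
               map_zero' := zero_pow hq0
               map_add' := FiniteField.add_pow_of_card_eq_sq hq hF } : F →+ F) f univ
  simp_rw [add_mul]
  rw [sum_add_distrib, key i j hi hj, zero_add, ← zero_pow hq0, ← key j i hj hi, hsum]
  refine sum_congr rfl fun a _ => ?_
  have ha : (a ^ (q * j)) ^ q = a ^ j := by
    rw [← pow_mul, show q * j * q = q ^ 2 * j by ring, pow_mul, ← hF, FiniteField.pow_card]
  rw [mul_pow, pow_add a (q * j), mul_pow (a ^ (q * j)), ha, ← pow_mul a i, pow_add, mul_comm i q,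
    mul_comm (a ^ j)]

theorem thm_qplus_len_plus_one_case2
    (q h τ r n : ℕ) (hq : IsPrimePow q) (hqo : Odd q)
    (hh : 0 < h) (hhe : Even h) (hτ : 1 ≤ τ)
    (hdiv : q + 1 = h * (2 * τ + 1))
    (hro : Odd r) (hr1 : 3 * h < 2 * r) (hr2 : r < 2 * h)  -- i.e. odd r, 3h/2 < r < 2h
    -- n = r(q²-1)/(2h) + 1
    (hn : 2 * h * n = r * (q ^ 2 - 1) + 2 * h)
    (k : ℕ) (hk1 : 1 ≤ k)
    -- k ≤ r(q+1)/(2h) - 3/2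
    (hk : 2 * h * k + 3 * h ≤ r * (q + 1))
    (F : Type*) [Field F] [Fintype F] (hF : Fintype.card F = q ^ 2) :
    ∃ a v : Fin n → F, Function.Injective a ∧ (∀ l, v l ≠ 0) ∧
      ∀ i j : ℕ, i < k → j < k →
        ∑ l, v l ^ (q + 1) * a l ^ (q * i + j) = 0 := by
  classical
  have hT3 : 3 * h ≤ q + 1 := by rw [hdiv]; nlinarith
  have hh2 : 2 ≤ h := by obtain ⟨c, rfl⟩ := hhe; omega
  have hq5 : 5 ≤ q := by omega
  obtain ⟨m, hm⟩ : ∃ m, 2 * m = (q - 1) * (2 * τ + 1) := by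
    obtain ⟨c, rfl⟩ := hqo
    exact ⟨c * (2 * τ + 1), by simp; ring⟩
  have hqm : q ^ 2 - 1 = 2 * h * m := by
    have : q ^ 2 - 1 = (q + 1) * (q - 1) := by rw [← Nat.sq_sub_sq, one_pow]
    rw [this, hdiv, mul_right_comm 2 h m, hm]; ring
  have hm0 : 0 < m := by
    have : 0 < (q - 1) * (2 * τ + 1) := Nat.mul_pos (by omega) (by omega)
    omega
  have hnm : n = r * m + 1 := by
    rw [hqm] at hn
    exact Nat.eq_of_mul_eq_mul_left (show 0 < 2 * h by omega) (by rw [hn]; ring)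
  obtain ⟨z, hz⟩ : ∃ z, r + z = 2 * h := ⟨2 * h - r, by omega⟩
  set M := m * (h - 1) with hM
  have hM0 : M ≠ 0 := (Nat.mul_pos hm0 (by omega)).ne'
  have hcard : Fintype.card Fˣ = 2 * h * m := by rw [Fintype.card_units, hF, hqm]
  have hgcd : (Fintype.card Fˣ).gcd M = m := by
    rw [hcard, hM, mul_comm (2 * h) m, Nat.gcd_mul_left]
    have : Nat.Coprime (2 * h) (h - 1) := by
      refine Nat.Coprime.mul_left ?_ ?_
      · rw [Nat.coprime_two_left]
        exact Nat.Even.sub_odd (by omega) hhe odd_one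
      · exact (Nat.coprime_self_sub_right (by omega)).2 (Nat.coprime_one_right h)
    rw [this.gcd_eq_one, mul_one]
  -- the values of `a ^ M` on units, and the chosen set `Z` of zeros among them
  let R : Finset Fˣ := univ.image (fun g => g ^ M)
  have hR : #R = 2 * h := by
    have h1 := IsCyclic.card_filter_pow_mem M (Z := R) (by simp [R])
    rw [filter_true_of_mem (by simp [R]), card_univ, hgcd, hcard] at h1
    exact (Nat.eq_of_mul_eq_mul_right hm0 h1).symm
  obtain ⟨Z, hZR, hZ⟩ := exists_subset_card_eq (s := R) (n := z) (by omega)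
  let Z' : Finset F := Z.image Units.val
  have h0Z : (0 : F) ∉ Z' := by simp [Z']
  have hZ' : #Z' = z := by rw [card_image_of_injective _ Units.val_injective, hZ]
  let Q : Polynomial F := ∏ ζ ∈ Z', (Polynomial.X - Polynomial.C ζ)
  have hQ : ∀ x, Q.eval x = 0 ↔ x ∈ Z' := by
    intro x
    simp [Q, Polynomial.eval_prod, prod_eq_zero_iff, sub_eq_zero]
  have hQdeg : Q.natDegree = z := by
    rw [Polynomial.natDegree_prod_of_monic _ _ fun ζ _ => Polynomial.monic_X_sub_C ζ]
    simp [hZ']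
  let Y : Finset F := insert 0 ((R \ Z).image Units.val)
  have hY : ∀ a : F, a ^ M ∉ Z' → a ^ M ∈ Y := by
    intro a ha
    rcases eq_or_ne a 0 with rfl | h0
    · simp [Y, hM0]
    · refine mem_insert_of_mem (mem_image.2 ⟨Units.mk0 a h0 ^ M, ?_, by simp⟩)
      refine mem_sdiff.2 ⟨by simp [R], fun hc => ha ?_⟩
      exact mem_image.2 ⟨_, hc, by simp⟩
  have hYQ : (0 : F) ∉ Y.image (fun y => Q.eval y) := by
    intro hc
    obtain ⟨y, hy, hy0⟩ := mem_image.1 hc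
    rw [hQ] at hy0
    rcases mem_insert.1 hy with rfl | hy
    · exact h0Z hy0
    · obtain ⟨y', hy', rfl⟩ := mem_image.1 hy
      obtain ⟨y'', hy'', h⟩ := mem_image.1 hy0
      exact (mem_sdiff.1 hy').2 (Units.val_injective h ▸ hy'')
  have hYcard : #(Y.image (fun y => Q.eval y)) < q := by
    have h1 : #(R \ Z) = r := by rw [card_sdiff_of_subset hZR]; omega
    have h2 : #Y ≤ #(R \ Z) + 1 := (card_insert_le _ _).trans (by gcongr; exact card_image_le)
    have h3 : #(Y.image (fun y => Q.eval y)) ≤ #Y := card_image_le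
    omega
  obtain ⟨α, hα⟩ := FiniteField.exists_trace_ne_zero hF (by omega) hYQ hYcard
  let P : Polynomial F := Polynomial.C α * Q
  let u : F → F := fun a => P.eval (a ^ M) + P.eval (a ^ M) ^ q
  have huq : ∀ a, u a ^ q = u a := by
    intro a
    simp only [u]
    rw [FiniteField.add_pow_of_card_eq_sq hq hF, ← pow_mul, ← sq, ← hF, FiniteField.pow_card,
      add_comm]
  have hu0 : ∀ a, a ^ M ∈ Z' → u a = 0 := by
    intro a ha
    have : P.eval (a ^ M) = 0 := by simp [P, (hQ _).2 ha]
    simp [u, this, hq.ne_zero]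
  have hu1 : ∀ a, a ^ M ∉ Z' → u a ≠ 0 := by
    intro a ha
    have := hα _ (mem_image_of_mem (fun y => Q.eval y) (hY a ha))
    simpa [u, P] using this
  let G : Finset F := univ.filter (fun a => a ^ M ∉ Z')
  have hG : #G = n := by
    have h1 : #{a : F | a ^ M ∈ Z'} = z * m := by
      have h2 := IsCyclic.card_filter_pow_mem M (Z := Z) (fun ζ hζ => by simpa [R] using hZR hζ)
      rw [hgcd, hZ] at h2
      rw [← h2, ← card_image_of_injective _ Units.val_injective]
      congr 1
      ext a
      simp only [mem_filter, mem_univ, true_and, mem_image, Z']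
      constructor
      · rintro ⟨ζ, hζ, h⟩
        have ha : a ≠ 0 := by
          rintro rfl
          rw [zero_pow hM0] at h
          exact ζ.ne_zero h
        refine ⟨Units.mk0 a ha, ?_, rfl⟩
        convert hζ
        ext
        simp [h]
      · rintro ⟨g, hg, rfl⟩
        exact ⟨_, hg, by simp⟩
    have h3 := card_filter_add_card_filter_not (s := (univ : Finset F)) (fun a => a ^ M ∈ Z')
    rw [h1, card_univ, hF] at h3
    have h4 : r * m + z * m = 2 * h * m := by rw [← add_mul, hz]
    have h5 : 0 < q ^ 2 := by positivity
    simp only [G]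
    omega
  choose! v hv using fun a ha =>
    FiniteField.exists_pow_succ_eq hF (by omega) (hu1 a ha) (huq a)
  let ε := (G.equivFinOfCardEq hG).symm
  have hε : ∀ l, (ε l : F) ^ M ∉ Z' := fun l => (mem_filter.1 (ε l).2).2
  refine ⟨fun l => ε l, fun l => v (ε l), Subtype.val_injective.comp ε.injective, ?_, ?_⟩
  · intro l h0
    apply hu1 _ (hε l)
    have h0' : v (ε l) = 0 := h0
    rw [← hv _ (hε l), h0', zero_pow (by omega)]
  · intro i j hi hj
    have hPdeg : P.natDegree ≤ z := hQdeg ▸ Polynomial.natDegree_C_mul_le α Q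
    have hsum := sum_trace_mul_pow_eq_zero hq hF P M k (fun e i j he hi hj ⟨t, ht⟩ => by
      have h1 : ((h - 1 : ℕ) : ℤ) = h - 1 := by push_cast [show 1 ≤ h by omega]; ring
      have h2 : ((q - 1 : ℕ) : ℤ) = q - 1 := by push_cast [show 1 ≤ q by omega]; ring
      obtain ⟨hi', hj', he'⟩ := exponent_eq_zero q h (2 * τ + 1) τ r k m i j e t
        (by exact_mod_cast hh2) (by exact_mod_cast hhe) (by exact_mod_cast hτ) rfl
        (by exact_mod_cast hdiv) (by rw [← h2]; exact_mod_cast hm) (by exact_mod_cast hro)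
        (by exact_mod_cast hr1) (by exact_mod_cast hr2)
        (by
          have h3 : h * (2 * k + 3) ≤ h * (r * (2 * τ + 1)) := by
            rw [hdiv] at hk; linarith
          exact_mod_cast Nat.le_of_mul_le_mul_left h3 hh)
        (by positivity) (by positivity) (by exact_mod_cast hi) (by exact_mod_cast hj)
        (by positivity) (by omega)
        (by
          rw [hqm, hM] at ht
          rw [← h1]
          have h4 : ((m * (h - 1) * e + (q * i + j) : ℕ) : ℤ) = (2 * h * m * t : ℕ) := by rw [ht]
          push_cast at h4
          linarith)
      simp only [Nat.cast_eq_zero] at hi' hj' he'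
      simp [hi', hj', he']) hi hj
    calc ∑ l, v (ε l) ^ (q + 1) * (ε l : F) ^ (q * i + j)
        = ∑ l, u (ε l) * (ε l : F) ^ (q * i + j) :=
          sum_congr rfl fun l _ => by rw [hv _ (hε l)]
      _ = ∑ a : G, u a * (a : F) ^ (q * i + j) :=
          ε.sum_comp (fun a : G => u a * (a : F) ^ (q * i + j))
      _ = ∑ a ∈ G, u a * a ^ (q * i + j) := sum_coe_sort G (fun a => u a * a ^ (q * i + j))
      _ = ∑ a, u a * a ^ (q * i + j) := by
          refine sum_subset (subset_univ G) fun a _ ha => ?_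
          rw [hu0 a (by simpa [G] using ha), zero_mul]
      _ = 0 := hsum
end
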